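/- Let |G⟩ be an n-qubit graph state with stabilizer S, let S_d be the subgroup of S generated by all elements of weight at most d, and let η(|G⟩) be the minimal d with S_d = S. For d < η(|G⟩), the d-body Hamiltonian H'' := −∑_{g ∈ S, wt(g) ≤ d} g has |G⟩ as a ground state, and the eigenspace of H'' for its smallest eigenvalue has dimension exactly 2^n · |S_d|^{−1}. -/

import Mathlib

open Matrix BigOperators
open scoped Classical

noncomputable section

/-- The state space of `n` qubits, `(ℂ²)^{⊗n}`, realized as functions from bit strings to `ℂ`. -/
abbrev QState (n : ℕ) : Type := (Fin n → Fin 2) → ℂ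

/-- Operators on `n` qubits. -/
abbrev QOp (n : ℕ) : Type := Matrix (Fin n → Fin 2) (Fin n → Fin 2) ℂ

/-- The single qubit Pauli matrices: `0 ↦ σ₀ = I`, `1 ↦ σ_x`, `2 ↦ σ_y`, `3 ↦ σ_z`. -/
def pauli1 (k : Fin 4) : Matrix (Fin 2) (Fin 2) ℂ :=
  if k = 0 then 1
  else if k = 1 then !![0, 1; 1, 0]
  else if k = 2 then !![0, -Complex.I; Complex.I, 0]
  else !![1, 0; 0, -1]

/-- The `n`-qubit Pauli operator `σ_{f 0} ⊗ σ_{f 1} ⊗ ⋯ ⊗ σ_{f (n-1)}`. -/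
def pauliOp {n : ℕ} (f : Fin n → Fin 4) : QOp n :=
  Matrix.of fun v w => ∏ i, pauli1 (f i) (v i) (w i)

/-- The support of a Pauli operator: the qubits on which it acts nontrivially. -/
def pSupport {n : ℕ} (f : Fin n → Fin 4) : Finset (Fin n) :=
  Finset.univ.filter fun i => f i ≠ 0

/-- The weight of a Pauli operator: the number of qubits on which it acts nontrivially. -/
def pWeight {n : ℕ} (f : Fin n → Fin 4) : ℕ := (pSupport f).card

/-- `g` is the signed Pauli operator `±σ_f`. -/
def IsSignedPauli {n : ℕ} (g : QOp n) (f : Fin n → Fin 4) : Prop :=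
  g = pauliOp f ∨ g = -pauliOp f

/-- The squared norm `∑_v |ψ_v|²` of an `n`-qubit state. -/
def qNormSq {n : ℕ} (ψ : QState n) : ℝ := ∑ v, Complex.normSq (ψ v)

/-- The inner product `⟨φ|ψ⟩` (antilinear in the first argument). -/
def qInner {n : ℕ} (φ ψ : QState n) : ℂ := ∑ v, starRingEnd ℂ (φ v) * ψ v

/-- The graph state correlation operator `K_a = σ_x^(a) ∏_{b ∈ N(a)} σ_z^(b)`. -/
def Kop {n : ℕ} (G : SimpleGraph (Fin n)) [DecidableRel G.Adj] (a : Fin n) : QOp n :=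
  pauliOp fun b => if b = a then 1 else if G.Adj a b then 3 else 0

/-- `ψ` is the graph state `|G⟩`: a unit vector fixed by all correlation operators `K_a`. -/
def IsGraphState {n : ℕ} (G : SimpleGraph (Fin n)) [DecidableRel G.Adj] (ψ : QState n) : Prop :=
  qNormSq ψ = 1 ∧ ∀ a : Fin n, Kop G a *ᵥ ψ = ψ

/-- The stabilizer of `ψ`: all signed Pauli operators `g = ±σ` with `g ψ = ψ`. -/
def stab {n : ℕ} (ψ : QState n) : Set (QOp n) :=
  {g | (∃ f, IsSignedPauli g f) ∧ g *ᵥ ψ = ψ}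

/-- The stabilizer elements of weight at most `d`. -/
def stabW {n : ℕ} (ψ : QState n) (d : ℕ) : Set (QOp n) :=
  {g | g ∈ stab ψ ∧ ∃ f, IsSignedPauli g f ∧ pWeight f ≤ d}

/-- `S_d`: the subgroup of the stabilizer generated by all elements of weight at most `d`,
as a set of operators.  (Since the stabilizer is a finite group, the generated submonoid
coincides with the generated subgroup.) -/
def SdSet {n : ℕ} (ψ : QState n) (d : ℕ) : Set (QOp n) :=
  (Submonoid.closure (stabW ψ d) : Set (QOp n))

/-- `δ(|ψ⟩)`: the minimal weight of a nonidentity element of the stabilizer of `ψ`. -/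
def deltaG {n : ℕ} (ψ : QState n) : ℕ :=
  sInf {d | ∃ g ∈ stab ψ, g ≠ 1 ∧ ∃ f, IsSignedPauli g f ∧ pWeight f = d}

/-- `η(|ψ⟩)`: the minimal `d` such that `S_d = S`. -/
def etaG {n : ℕ} (ψ : QState n) : ℕ :=
  sInf {d | stab ψ ⊆ SdSet ψ d}

/-- A `d`-body Hamiltonian on `n` qubits: a real linear combination of Pauli operators
of weight at most `d`. -/
def IsDBody {n : ℕ} (d : ℕ) (H : QOp n) : Prop :=
  ∃ h : (Fin n → Fin 4) → ℝ, (∀ f, d < pWeight f → h f = 0) ∧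
    H = ∑ f : Fin n → Fin 4, (h f : ℂ) • pauliOp f

/-- A Hamiltonian is nontrivial if it is nonzero and not a multiple of the identity. -/
def NontrivialHam {n : ℕ} (H : QOp n) : Prop :=
  H ≠ 0 ∧ ∀ c : ℂ, H ≠ c • (1 : QOp n)

/-- `φ` is an eigenvector of `H` with (real) eigenvalue `E`. -/
def IsEigenpair {n : ℕ} (H : QOp n) (E : ℝ) (φ : QState n) : Prop :=
  φ ≠ 0 ∧ H *ᵥ φ = (E : ℂ) • φ

/-- `ψ` is a ground state of `H` with ground energy `E`: an eigenvector for the smallest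
eigenvalue `E` of `H`. -/
def IsGroundStateE {n : ℕ} (H : QOp n) (ψ : QState n) (E : ℝ) : Prop :=
  IsEigenpair H E ψ ∧ ∀ E' φ, IsEigenpair H E' φ → E ≤ E'

/-- `ψ` is a ground state of `H`. -/
def IsGroundState {n : ℕ} (H : QOp n) (ψ : QState n) : Prop :=
  ∃ E, IsGroundStateE H ψ E

/-- The dimension of the eigenspace of `H` for the eigenvalue `E` (the multiplicity of `E`). -/
def eigDim {n : ℕ} (H : QOp n) (E : ℝ) : ℕ :=
  Module.finrank ℂ (Module.End.eigenspace (Matrix.mulVecLin H) ((E : ℂ)))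


/-- The Hamiltonian `H'' = -∑_{g ∈ S, wt(g) ≤ d} g`: each stabilizer element `g = ±σ_f` of
weight at most `d` contributes `-g` to the sum. -/
noncomputable def Hle {n : ℕ} (ψ : QState n) (d : ℕ) : QOp n :=
  -(∑ f : Fin n → Fin 4,
      if pWeight f ≤ d then
        (if pauliOp f ∈ stab ψ then pauliOp f else 0) +
        (if -pauliOp f ∈ stab ψ then -pauliOp f else 0)
      else 0)

section PauliAlgebra

variable {n : ℕ}

lemma pauli1_mul_self (k : Fin 4) : pauli1 k * pauli1 k = 1 := by
  fin_cases k <;> ext i j <;> fin_cases i <;> fin_cases j <;> simp [pauli1, Matrix.mul_apply]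

lemma pauli1_isHermitian (k : Fin 4) : (pauli1 k).IsHermitian := by
  fin_cases k <;> ext i j <;> fin_cases i <;> fin_cases j <;> simp [pauli1]

lemma trace_pauli1 {k : Fin 4} (hk : k ≠ 0) : (pauli1 k).trace = 0 := by
  fin_cases k <;> simp_all [pauli1, Matrix.trace_fin_two]

lemma pauli1_mul_eq_smul (a b : Fin 4) :
    ∃ (c : ℂ) (k : Fin 4), pauli1 a * pauli1 b = c • pauli1 k := by
  suffices h : ∃ c : ℂ, pauli1 a * pauli1 b = c • pauli1 (a ^^^ b) from
    let ⟨c, hc⟩ := h; ⟨c, _, hc⟩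
  have h1 : (1 ^^^ 2 : Fin 4) = 3 ∧ (1 ^^^ 3 : Fin 4) = 2 ∧ (2 ^^^ 3 : Fin 4) = 1 ∧
    (2 ^^^ 1 : Fin 4) = 3 ∧ (3 ^^^ 1 : Fin 4) = 2 ∧ (3 ^^^ 2 : Fin 4) = 1 := by decide
  fin_cases a <;> fin_cases b <;>
    first
    | (refine ⟨1, ?_⟩
       ext i j; fin_cases i <;> fin_cases j <;> simp [pauli1, Matrix.mul_apply, h1]; done)
    | (refine ⟨Complex.I, ?_⟩
       ext i j; fin_cases i <;> fin_cases j <;> simp [pauli1, Matrix.mul_apply, h1]; done)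
    | (refine ⟨-Complex.I, ?_⟩
       ext i j; fin_cases i <;> fin_cases j <;> simp [pauli1, Matrix.mul_apply, h1])

lemma pauliOp_mul_apply (f g : Fin n → Fin 4) (v w : Fin n → Fin 2) :
    (pauliOp f * pauliOp g) v w = ∏ i, (pauli1 (f i) * pauli1 (g i)) (v i) (w i) := by
  simp only [Matrix.mul_apply, pauliOp, Matrix.of_apply, Finset.prod_univ_sum,
    Fintype.piFinset_univ, Finset.prod_mul_distrib]

lemma prod_one_apply (v w : Fin n → Fin 2) :
    ∏ i, (1 : Matrix (Fin 2) (Fin 2) ℂ) (v i) (w i) = (1 : QOp n) v w := by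
  simp only [Matrix.one_apply, Finset.prod_ite_zero, Finset.prod_const_one, Finset.mem_univ,
    true_implies, funext_iff]

lemma pauliOp_zero : pauliOp (0 : Fin n → Fin 4) = 1 := by
  ext v w
  simpa [pauliOp, pauli1] using prod_one_apply v w

lemma pauliOp_mul_self (f : Fin n → Fin 4) : pauliOp f * pauliOp f = 1 := by
  ext v w
  simp only [pauliOp_mul_apply, pauli1_mul_self, prod_one_apply]

lemma pauliOp_isHermitian (f : Fin n → Fin 4) : (pauliOp f).IsHermitian := by
  ext v w
  simp only [Matrix.conjTranspose_apply, pauliOp, Matrix.of_apply, star_prod]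
  exact Finset.prod_congr rfl fun i _ => (pauli1_isHermitian (f i)).apply _ _

lemma trace_pauliOp {f : Fin n → Fin 4} (hf : f ≠ 0) : (pauliOp f).trace = 0 := by
  obtain ⟨i, hi⟩ := Function.ne_iff.mp hf
  have h : (pauliOp f).trace = ∏ i, (pauli1 (f i)).trace := by
    simp only [Matrix.trace, Matrix.diag, pauliOp, Matrix.of_apply, Finset.prod_univ_sum,
      Fintype.piFinset_univ]
  rw [h]
  exact Finset.prod_eq_zero (Finset.mem_univ i) (trace_pauli1 hi)

lemma pauliOp_mul_eq_smul (f g : Fin n → Fin 4) :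
    ∃ (c : ℂ) (k : Fin n → Fin 4), pauliOp f * pauliOp g = c • pauliOp k := by
  choose c k h using pauli1_mul_eq_smul
  refine ⟨∏ i, c (f i) (g i), fun i => k (f i) (g i), ?_⟩
  ext v w
  rw [pauliOp_mul_apply]
  simp only [h, Matrix.smul_apply, smul_eq_mul, Finset.prod_mul_distrib, pauliOp, Matrix.of_apply]

lemma IsSignedPauli.mul_self {g : QOp n} {f : Fin n → Fin 4} (h : IsSignedPauli g f) :
    g * g = 1 := by
  rcases h with rfl | rfl <;> simp [pauliOp_mul_self]

lemma IsSignedPauli.isHermitian {g : QOp n} {f : Fin n → Fin 4} (h : IsSignedPauli g f) :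
    g.IsHermitian := by
  rcases h with rfl | rfl
  exacts [pauliOp_isHermitian f, (pauliOp_isHermitian f).neg]

/-- The product of two signed Pauli operators fixing a nonzero vector is a signed Pauli operator:
the phase it may carry has to be real. -/
lemma IsSignedPauli.exists_mul {ψ : QState n} (hψ : ψ ≠ 0) {g g' : QOp n} {f f' : Fin n → Fin 4}
    (h : IsSignedPauli g f) (h' : IsSignedPauli g' f') (hfix : (g * g') *ᵥ ψ = ψ) :
    ∃ k, IsSignedPauli (g * g') k := by
  obtain ⟨c, k, hk⟩ : ∃ (c : ℂ) (k : Fin n → Fin 4), g * g' = c • pauliOp k := by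
    obtain ⟨c, k, hk⟩ := pauliOp_mul_eq_smul f f'
    rcases h with rfl | rfl <;> rcases h' with rfl | rfl
    exacts [⟨c, k, hk⟩, ⟨-c, k, by simp [hk]⟩, ⟨-c, k, by simp [hk]⟩, ⟨c, k, by simp [hk]⟩]
  have hsq : (c * c) • ψ = ψ := by
    have h2 : ((g * g') * (g * g')) *ᵥ ψ = ψ := by
      rw [← Matrix.mulVec_mulVec, hfix, hfix]
    simpa [hk, pauliOp_mul_self, smul_smul, Matrix.smul_mulVec] using h2
  have hc : c * c = 1 := by
    have : (c * c - 1) • ψ = 0 := by rw [sub_smul, hsq, one_smul, sub_self]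
    exact sub_eq_zero.mp ((smul_eq_zero.mp this).resolve_right hψ)
  refine ⟨k, ?_⟩
  rcases mul_self_eq_one_iff.mp hc with rfl | rfl
  exacts [Or.inl (by simpa using hk), Or.inr (by simpa using hk)]

end PauliAlgebra

section Stabilizer

variable {n : ℕ}

/-- The stabilizer of a nonzero state, as a submonoid of the operators. -/
def stabSubmonoid (ψ : QState n) (hψ : ψ ≠ 0) : Submonoid (QOp n) where
  carrier := stab ψ
  one_mem' := ⟨⟨0, Or.inl pauliOp_zero.symm⟩, Matrix.one_mulVec ψ⟩
  mul_mem' := by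
    rintro g g' ⟨⟨f, hf⟩, hg⟩ ⟨⟨f', hf'⟩, hg'⟩
    have hfix : (g * g') *ᵥ ψ = ψ := by rw [← Matrix.mulVec_mulVec, hg', hg]
    exact ⟨hf.exists_mul hψ hf' hfix, hfix⟩

lemma SdSet_subset_stab {ψ : QState n} (hψ : ψ ≠ 0) (d : ℕ) : SdSet ψ d ⊆ stab ψ :=
  (Submonoid.closure_le (S := stabSubmonoid ψ hψ)).mpr fun _ hg => hg.1

lemma stab_finite (ψ : QState n) : (stab ψ).Finite := by
  refine ((Set.finite_range (pauliOp (n := n))).union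
    (Set.finite_range fun f : Fin n → Fin 4 => -pauliOp f)).subset ?_
  rintro g ⟨⟨f, rfl | rfl⟩, -⟩
  exacts [Or.inl ⟨f, rfl⟩, Or.inr ⟨f, rfl⟩]

lemma trace_eq_zero_of_mem_stab {ψ : QState n} (hψ : ψ ≠ 0) {g : QOp n} (hg : g ∈ stab ψ)
    (hg1 : g ≠ 1) : g.trace = 0 := by
  obtain ⟨⟨f, hf⟩, hfix⟩ := hg
  have hf0 : f ≠ 0 := by
    rintro rfl
    rcases hf with rfl | rfl
    · exact hg1 pauliOp_zero
    · rw [pauliOp_zero, Matrix.neg_mulVec, Matrix.one_mulVec, neg_eq_self] at hfix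
      exact hψ hfix
  rcases hf with rfl | rfl <;> simp [trace_pauliOp hf0]

end Stabilizer

section FixedSpace

variable {ι : Type*} [Fintype ι] [DecidableEq ι]

/-- The common fixed space of a set of matrices. -/
def fixedSpace (S : Set (Matrix ι ι ℂ)) : Submodule ℂ (ι → ℂ) where
  carrier := {φ | ∀ g ∈ S, g *ᵥ φ = φ}
  zero_mem' := fun g _ => Matrix.mulVec_zero g
  add_mem' := fun hx hy g hg => by rw [Matrix.mulVec_add, hx g hg, hy g hg]
  smul_mem' := fun c x hx g hg => by rw [Matrix.mulVec_smul, hx g hg]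

lemma fixedSpace_closure (T : Set (Matrix ι ι ℂ)) :
    fixedSpace (Submonoid.closure T : Set (Matrix ι ι ℂ)) = fixedSpace T := by
  refine le_antisymm (fun φ hφ g hg => hφ g (Submonoid.subset_closure hg)) fun φ hφ g hg => ?_
  induction hg using Submonoid.closure_induction with
  | mem g hg => exact hφ g hg
  | one => exact Matrix.one_mulVec φ
  | mul g h _ _ ihg ihh => rw [← Matrix.mulVec_mulVec, ihh, ihg]

/-- A finite group of involutions all of whose nonidentity elements are traceless has a fixed
space of dimension `card ι / card M`. -/
lemma card_mul_finrank_fixedSpace (M : Submonoid (Matrix ι ι ℂ))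
    (hfin : (M : Set (Matrix ι ι ℂ)).Finite) (hinv : ∀ g ∈ M, g * g = 1)
    (htr : ∀ g ∈ M, g ≠ 1 → g.trace = 0) :
    (M : Set (Matrix ι ι ℂ)).ncard *
      Module.finrank ℂ (fixedSpace (M : Set (Matrix ι ι ℂ))) = Fintype.card ι := by
  set F : Finset (Matrix ι ι ℂ) := hfin.toFinset with hF
  have hmem : ∀ g, g ∈ F ↔ g ∈ M := fun g => by simp [hF]
  have hcard : (M : Set (Matrix ι ι ℂ)).ncard = F.card := Set.ncard_eq_toFinset_card _ hfin
  have hF0 : (F.card : ℂ) ≠ 0 :=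
    Nat.cast_ne_zero.mpr (Finset.card_ne_zero_of_mem ((hmem 1).mpr M.one_mem))
  have hleft : ∀ h ∈ M, h * ∑ g ∈ F, g = ∑ g ∈ F, g := fun h hh => by
    rw [Finset.mul_sum]
    refine Finset.sum_bij' (fun g _ => h * g) (fun g _ => h * g) ?_ ?_ ?_ ?_ ?_
    · exact fun g hg => (hmem _).mpr (M.mul_mem hh ((hmem g).mp hg))
    · exact fun g hg => (hmem _).mpr (M.mul_mem hh ((hmem g).mp hg))
    · exact fun g _ => by rw [← mul_assoc, hinv h hh, one_mul]
    · exact fun g _ => by rw [← mul_assoc, hinv h hh, one_mul]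
    · exact fun g _ => rfl
  have hproj : LinearMap.IsProj (fixedSpace (M : Set (Matrix ι ι ℂ)))
      (Matrix.toLin' ((F.card : ℂ)⁻¹ • ∑ g ∈ F, g)) := by
    refine ⟨fun x h hh => ?_, fun x hx => ?_⟩
    · rw [Matrix.toLin'_apply, Matrix.mulVec_mulVec, Matrix.mul_smul, hleft h hh]
    · rw [Matrix.toLin'_apply, Matrix.smul_mulVec, Matrix.sum_mulVec,
        Finset.sum_congr rfl fun g hg => hx g ((hmem g).mp hg), Finset.sum_const,
        ← Nat.cast_smul_eq_nsmul ℂ, inv_smul_smul₀ hF0]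
  have htrace := hproj.trace
  rw [Matrix.trace_toLin'_eq, Matrix.trace_smul, Matrix.trace_sum,
    Finset.sum_eq_single_of_mem 1 ((hmem 1).mpr M.one_mem)
      (fun g hg hg1 => htr g ((hmem g).mp hg) hg1), Matrix.trace_one, smul_eq_mul] at htrace
  rw [hcard]
  have : (F.card : ℂ) * Module.finrank ℂ (fixedSpace (M : Set (Matrix ι ι ℂ))) =
      Fintype.card ι := by
    rw [← htrace, mul_inv_cancel_left₀ hF0]
  exact_mod_cast this

end FixedSpace

section Frustration

open scoped ComplexOrder

variable {ι κ : Type*} [Fintype ι] [DecidableEq ι]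

lemma two_mul_star_dotProduct_sub_mulVec {g : Matrix ι ι ℂ} (hg : g.IsHermitian)
    (hinv : g * g = 1) (φ : ι → ℂ) :
    2 * (star φ ⬝ᵥ (φ - g *ᵥ φ)) = star (φ - g *ᵥ φ) ⬝ᵥ (φ - g *ᵥ φ) := by
  have h1 : star (g *ᵥ φ) ⬝ᵥ φ = star φ ⬝ᵥ g *ᵥ φ := by
    rw [Matrix.star_mulVec, hg.eq, ← Matrix.dotProduct_mulVec]
  have h2 : star (g *ᵥ φ) ⬝ᵥ (g *ᵥ φ) = star φ ⬝ᵥ φ := by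
    rw [Matrix.star_mulVec, hg.eq, ← Matrix.dotProduct_mulVec, Matrix.mulVec_mulVec, hinv,
      Matrix.one_mulVec]
  rw [star_sub, sub_dotProduct, dotProduct_sub, dotProduct_sub, h1, h2]
  ring

variable {F : Finset κ} {g : κ → Matrix ι ι ℂ}

lemma two_mul_energy_eq_sum (hherm : ∀ x ∈ F, (g x).IsHermitian)
    (hinv : ∀ x ∈ F, g x * g x = 1) {E : ℝ} {φ : ι → ℂ}
    (h : (-∑ x ∈ F, g x) *ᵥ φ = (E : ℂ) • φ) :
    2 * ((F.card + E : ℝ) * (star φ ⬝ᵥ φ)) =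
      ∑ x ∈ F, star (φ - g x *ᵥ φ) ⬝ᵥ (φ - g x *ᵥ φ) := by
  rw [← Finset.sum_congr rfl fun x hx =>
    two_mul_star_dotProduct_sub_mulVec (hherm x hx) (hinv x hx) φ, ← Finset.mul_sum,
    ← dotProduct_sum, Finset.sum_sub_distrib, sub_eq_add_neg, ← Matrix.sum_mulVec,
    ← Matrix.neg_mulVec, h, Finset.sum_const, ← Nat.cast_smul_eq_nsmul ℂ, ← add_smul,
    dotProduct_smul, smul_eq_mul]
  push_cast
  rfl

/-- The spectrum of `-∑ g` for Hermitian involutions `g` is bounded below by minus their number. -/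
lemma neg_card_le_of_eigenvector (hherm : ∀ x ∈ F, (g x).IsHermitian)
    (hinv : ∀ x ∈ F, g x * g x = 1) {E : ℝ} {φ : ι → ℂ} (hφ : φ ≠ 0)
    (h : (-∑ x ∈ F, g x) *ᵥ φ = (E : ℂ) • φ) : -(F.card : ℝ) ≤ E := by
  have hsum := two_mul_energy_eq_sum hherm hinv h
  have hnonneg : (0 : ℂ) ≤ 2 * ((F.card + E : ℝ) * (star φ ⬝ᵥ φ)) :=
    hsum ▸ Finset.sum_nonneg fun x _ => dotProduct_star_self_nonneg _
  have hpos : 0 < star φ ⬝ᵥ φ := dotProduct_star_self_pos_iff.mpr hφ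
  by_contra! hlt
  have hneg : ((F.card + E : ℝ) : ℂ) < 0 := by
    rw [← Complex.ofReal_zero, Complex.real_lt_real]
    linarith
  exact (mul_neg_of_pos_of_neg two_pos (mul_neg_of_neg_of_pos hneg hpos)).not_ge hnonneg

/-- A vector attains the lower bound exactly when it is fixed by every involution in the sum. -/
lemma neg_sum_mulVec_eq_neg_card_smul_iff (hherm : ∀ x ∈ F, (g x).IsHermitian)
    (hinv : ∀ x ∈ F, g x * g x = 1) {φ : ι → ℂ} :
    (-∑ x ∈ F, g x) *ᵥ φ = ((-(F.card : ℝ) : ℝ) : ℂ) • φ ↔ ∀ x ∈ F, g x *ᵥ φ = φ := by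
  refine ⟨fun h x hx => ?_, fun h => ?_⟩
  · have hsum := two_mul_energy_eq_sum hherm hinv h
    rw [add_neg_cancel, Complex.ofReal_zero, zero_mul, mul_zero, eq_comm,
      Finset.sum_eq_zero_iff_of_nonneg fun x _ => dotProduct_star_self_nonneg _] at hsum
    exact (sub_eq_zero.mp (dotProduct_star_self_eq_zero.mp (hsum x hx))).symm
  · rw [Matrix.neg_mulVec, Matrix.sum_mulVec, Finset.sum_congr rfl h, Finset.sum_const,
      ← Nat.cast_smul_eq_nsmul ℂ, Complex.ofReal_neg, neg_smul, Complex.ofReal_natCast]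

end Frustration

section Hamiltonian

variable {n : ℕ}

/-- The Pauli operator `σ_f` with sign `-` if the flag is set and `+` otherwise. -/
def signedPauliOp (x : (Fin n → Fin 4) × Bool) : QOp n :=
  if x.2 then -pauliOp x.1 else pauliOp x.1

lemma isSignedPauli_signedPauliOp (x : (Fin n → Fin 4) × Bool) :
    IsSignedPauli (signedPauliOp x) x.1 := by
  unfold signedPauliOp IsSignedPauli
  split_ifs <;> simp

/-- The labels of the summands of `Hle ψ d`. -/
def stabLabels (ψ : QState n) (d : ℕ) : Finset ((Fin n → Fin 4) × Bool) :=
  Finset.univ.filter fun x => pWeight x.1 ≤ d ∧ signedPauliOp x ∈ stab ψ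

lemma Hle_eq_neg_sum (ψ : QState n) (d : ℕ) :
    Hle ψ d = -∑ x ∈ stabLabels ψ d, signedPauliOp x := by
  rw [Hle, stabLabels, Finset.sum_filter, Fintype.sum_prod_type]
  congr 1
  refine Finset.sum_congr rfl fun f _ => ?_
  by_cases hf : pWeight f ≤ d <;> simp [hf, signedPauliOp, add_comm]

lemma image_stabLabels (ψ : QState n) (d : ℕ) :
    signedPauliOp '' (stabLabels ψ d : Set ((Fin n → Fin 4) × Bool)) = stabW ψ d := by
  ext g
  constructor
  · rintro ⟨x, hx, rfl⟩
    obtain ⟨hd, hx⟩ := (Finset.mem_filter.mp hx).2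
    exact ⟨hx, x.1, isSignedPauli_signedPauliOp x, hd⟩
  · rintro ⟨hg, f, rfl | rfl, hd⟩
    · exact ⟨(f, false), Finset.mem_filter.mpr ⟨Finset.mem_univ _, hd, hg⟩, rfl⟩
    · exact ⟨(f, true), Finset.mem_filter.mpr ⟨Finset.mem_univ _, hd, hg⟩, rfl⟩

lemma isDBody_Hle (ψ : QState n) (d : ℕ) : IsDBody d (Hle ψ d) := by
  refine ⟨fun f => if pWeight f ≤ d then
    (if -pauliOp f ∈ stab ψ then 1 else 0) - (if pauliOp f ∈ stab ψ then 1 else 0) else 0,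
    fun f hf => if_neg hf.not_ge, ?_⟩
  rw [Hle, ← Finset.sum_neg_distrib]
  refine Finset.sum_congr rfl fun f _ => ?_
  by_cases hf : pWeight f ≤ d <;> by_cases h : pauliOp f ∈ stab ψ <;>
    by_cases h' : -pauliOp f ∈ stab ψ <;> simp [hf, h, h']

lemma mulVec_Hle_eq_iff (ψ : QState n) (d : ℕ) {φ : QState n} :
    Hle ψ d *ᵥ φ = ((-((stabLabels ψ d).card : ℝ) : ℝ) : ℂ) • φ ↔ φ ∈ fixedSpace (SdSet ψ d) := by
  rw [SdSet, fixedSpace_closure, ← image_stabLabels, Hle_eq_neg_sum,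
    neg_sum_mulVec_eq_neg_card_smul_iff
      (fun x _ => (isSignedPauli_signedPauliOp x).isHermitian)
      (fun x _ => (isSignedPauli_signedPauliOp x).mul_self)]
  exact (Set.forall_mem_image (p := fun g : QOp n => g *ᵥ φ = φ)).symm

lemma eigDim_Hle (ψ : QState n) (d : ℕ) :
    eigDim (Hle ψ d) (-((stabLabels ψ d).card : ℝ)) =
      Module.finrank ℂ (fixedSpace (SdSet ψ d)) := by
  rw [eigDim]
  suffices h : Module.End.eigenspace (Matrix.mulVecLin (Hle ψ d))
      ((-((stabLabels ψ d).card : ℝ) : ℝ) : ℂ) = fixedSpace (SdSet ψ d) by rw [h]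
  ext φ
  rw [Module.End.mem_eigenspace_iff, Matrix.mulVecLin_apply, mulVec_Hle_eq_iff]

lemma IsGraphState.ne_zero {G : SimpleGraph (Fin n)} [DecidableRel G.Adj] {ψ : QState n}
    (hψ : IsGraphState G ψ) : ψ ≠ 0 := by
  rintro rfl
  simpa [qNormSq] using hψ.1

end Hamiltonian

/-- let `|G⟩` be an `n`-qubit graph state with stabilizer `S` and `d < η(|G⟩)`;
write `r = 2^n·|S_d|⁻¹`, i.e. `|S_d| * r = 2^n`.  The `d`-body Hamiltonian
`H'' = -∑_{g ∈ S, wt(g) ≤ d} g` has `|G⟩` as a ground state, and the eigenspace of `H''` for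
its smallest eigenvalue has dimension exactly `r = 2^n·|S_d|⁻¹`. -/
theorem Hle_ground_space_dimension
    {n : ℕ} (G : SimpleGraph (Fin n)) [DecidableRel G.Adj]
    (ψ : QState n) (hψ : IsGraphState G ψ)
    (d : ℕ) (hd : d < etaG ψ)
    (r : ℕ) (hr : Set.ncard (SdSet ψ d) * r = 2 ^ n) :
    IsDBody d (Hle ψ d) ∧
    ∃ E : ℝ, IsGroundStateE (Hle ψ d) ψ E ∧ eigDim (Hle ψ d) E = r := by
  have hψ0 := hψ.ne_zero
  have hsub := SdSet_subset_stab hψ0 d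
  refine ⟨isDBody_Hle ψ d, -((stabLabels ψ d).card : ℝ), ⟨⟨hψ0, ?_⟩, fun E' φ hφ => ?_⟩, ?_⟩
  · exact (mulVec_Hle_eq_iff ψ d).mpr fun g hg => (hsub hg).2
  · refine neg_card_le_of_eigenvector
      (fun x _ => (isSignedPauli_signedPauliOp x).isHermitian)
      (fun x _ => (isSignedPauli_signedPauliOp x).mul_self) hφ.1 ?_
    rw [← Hle_eq_neg_sum]
    exact hφ.2
  · have hfin : (SdSet ψ d).Finite := (stab_finite ψ).subset hsub
    have hdim := card_mul_finrank_fixedSpace (Submonoid.closure (stabW ψ d)) hfin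
      (fun g hg => let ⟨_, hf⟩ := (hsub hg).1; hf.mul_self)
      (fun g hg hg1 => trace_eq_zero_of_mem_stab hψ0 (hsub hg) hg1)
    have hcard : Set.ncard (SdSet ψ d) * Module.finrank ℂ (fixedSpace (SdSet ψ d)) = 2 ^ n :=
      hdim.trans (by simp)
    have hpos : 0 < Set.ncard (SdSet ψ d) :=
      (Set.ncard_pos hfin).mpr ⟨1, (Submonoid.closure (stabW ψ d)).one_mem⟩
    rw [eigDim_Hle]
    exact Nat.eq_of_mul_eq_mul_left hpos (hcard.trans hr.symm)

end
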